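/- Let m ∈ ℝ with m ≠ 0, m₀ := max{0, m}, r₀ > 2m₀, and let ℓ ≥ 2 be an integer. Suppose a : [r₀,∞) → ℝ is twice continuously differentiable, solves the Schwarzschild radial ODE with parameters (m, r₀, ℓ), satisfies the Bartnik initial condition, and a(r₀) ≠ 0. Define α₀ := (3/2 + (r₀/(4m))·(ℓ(ℓ+1)−2))·a(r₀), β₀ := 4m²·α₀/(ℓ(ℓ+1)−2), and B(r) := a(r) − β₀/(r(r−2m)). Then at least one of the following holds: (i) B(r) → +∞ as r → ∞; (ii) B(r) → −∞ as r → ∞; (iii) if a'(r) → 0 as r → ∞, then a(r) does not converge to any finite limit as r → ∞. -/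

import Mathlib

open Set Filter

lemma swz_mono (r₁ : ℝ) (f f' : ℝ → ℝ)
    (hf : ∀ r ∈ Ici r₁, HasDerivWithinAt f (f' r) (Ici r₁) r)
    (hn : ∀ r ∈ Ici r₁, 0 ≤ f' r) : MonotoneOn f (Ici r₁) := by
  apply monotoneOn_of_hasDerivWithinAt_nonneg (f' := f') (convex_Ici r₁)
  · exact fun r hr => (hf r hr).continuousWithinAt
  · exact fun r hr => (hf r (interior_subset hr)).mono interior_subset
  · exact fun r hr => hn r (interior_subset hr)

/-- scaled slope numerator -/
noncomputable def swzN (m k r : ℝ) : ℝ :=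
  k * (r * (r - 2 * m)) * (r * (k + 2) / 2 - m) + (2 * r - 2 * m) * (6 * m ^ 2 + k * m * r)

/-- scaled value numerator -/
noncomputable def swzD (m k r : ℝ) : ℝ := k * r * (r - 3 * m) - 6 * m ^ 2

/-- derivative of swzN -/
noncomputable def swzN' (m k r : ℝ) : ℝ :=
  k * (2 * r - 2 * m) * (r * (k + 2) / 2 - m) + k * (r * (r - 2 * m)) * ((k + 2) / 2)
    + 2 * (6 * m ^ 2 + k * m * r) + (2 * r - 2 * m) * (k * m)

lemma swzN_deriv (m k r : ℝ) : HasDerivAt (swzN m k) (swzN' m k r) r := by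
  have hid := hasDerivAt_id' r
  have h1 := ((hid.mul (hid.sub_const (2 * m))).const_mul k).mul
    (((hid.mul_const (k + 2)).div_const 2).sub_const m)
  have h2 := ((hid.const_mul 2).sub_const (2 * m)).mul ((hid.const_mul (k * m)).const_add (6 * m ^ 2))
  have h3 := h1.add h2
  refine h3.congr_deriv ?_
  unfold swzN'
  simp
  ring

lemma swzD_deriv (m k r : ℝ) : HasDerivAt (swzD m k) (k * (2 * r - 3 * m)) r := by
  have hid := hasDerivAt_id' r
  have h1 := ((hid.const_mul k).mul (hid.sub_const (3 * m))).sub_const (6 * m ^ 2)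
  refine h1.congr_deriv ?_
  ring

lemma swz_E (m k r : ℝ) :
    swzN m k r ^ 2 - r * (r - 2 * m) * (k * (2 * r - 3 * m) * swzN m k r - swzD m k r * swzN' m k r)
      - (4 * m ^ 2 + (k + 2) * (r * (r - 2 * m))) * swzD m k r ^ 2
      = k * (k + 2) / 4 * (r * (r - 2 * m) * (k * r + 6 * m)) ^ 2 := by
  unfold swzN swzN' swzD
  ring

lemma swzN_pos (m k r : ℝ) (hm : m ≠ 0) (hk : 0 < k) (h1 : 0 < r) (h2 : 0 < r - 2 * m) :
    0 < swzN m k r := by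
  rcases lt_or_gt_of_ne hm with h | h
  · obtain ⟨w, rfl⟩ : ∃ w, m = -w := ⟨-m, by ring⟩
    have hw : 0 < w := by linarith
    have : swzN (-w) k r = 12 * w ^ 3 + 12 * w ^ 2 * r + (k + k ^ 2) * w * r ^ 2
        + (k + k ^ 2 / 2) * r ^ 3 := by unfold swzN; ring
    rw [this]; positivity
  · obtain ⟨t, rfl⟩ : ∃ t, r = t + 2 * m := ⟨r - 2 * m, by ring⟩
    have ht : 0 < t := by linarith
    have : swzN m k (t + 2 * m) = (12 + 4 * k) * m ^ 3 + (12 + 8 * k + 2 * k ^ 2) * m ^ 2 * t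
        + (5 * k + 2 * k ^ 2) * m * t ^ 2 + (k + k ^ 2 / 2) * t ^ 3 := by unfold swzN; ring
    rw [this]; positivity

/-- A solution with a finite limit has `B * Q ≤ 0`. -/
lemma swz_V (m r₀ k : ℝ) (hk : 0 < k) (hr : 0 < r₀) (hr2 : 0 < r₀ - 2 * m) (B Q : ℝ → ℝ)
    (hB : ∀ r ∈ Ici r₀, HasDerivWithinAt B (Q r / (r * (r - 2 * m))) (Ici r₀) r)
    (hQ : ∀ r ∈ Ici r₀, HasDerivWithinAt Q
      ((4 * m ^ 2 / (r * (r - 2 * m)) + (k + 2)) * B r) (Ici r₀) r)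
    (L : ℝ) (hL : Tendsto B atTop (nhds L)) : ∀ r ∈ Ici r₀, B r * Q r ≤ 0 := by
  intro r₁ hr₁
  by_contra hV
  push Not at hV
  have hr₁' : r₀ ≤ r₁ := hr₁
  have hsub : Ici r₁ ⊆ Ici r₀ := Ici_subset_Ici.2 hr₁'
  have hp : ∀ r ∈ Ici r₀, 0 < r * (r - 2 * m) := fun r h => by
    have : r₀ ≤ r := h
    exact mul_pos (by linarith) (by linarith)
  have hVd : ∀ r ∈ Ici r₀, HasDerivWithinAt (fun s => B s * Q s)
      (Q r ^ 2 / (r * (r - 2 * m)) + (4 * m ^ 2 / (r * (r - 2 * m)) + (k + 2)) * B r ^ 2)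
      (Ici r₀) r := fun r h => by
    refine ((hB r h).mul (hQ r h)).congr_deriv ?_
    ring
  have hVm : MonotoneOn (fun s => B s * Q s) (Ici r₀) := by
    refine swz_mono _ _ _ hVd fun r h => ?_
    have := hp r h
    positivity
  have hVpos : ∀ r ∈ Ici r₁, 0 < B r * Q r := fun r h =>
    lt_of_lt_of_le hV (hVm hr₁ (hsub h) h)
  have hSd : ∀ r ∈ Ici r₀, HasDerivWithinAt (fun s => B s ^ 2)
      (2 * (B r * Q r) / (r * (r - 2 * m))) (Ici r₀) r := fun r h => by
    refine ((hB r h).pow 2).congr_deriv ?_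
    simp; ring
  have hSm : MonotoneOn (fun s => B s ^ 2) (Ici r₁) := by
    refine swz_mono _ _ _ (fun r h => (hSd r (hsub h)).mono hsub) fun r h => ?_
    have := hp r (hsub h)
    have := hVpos r h
    positivity
  set b := B r₁ ^ 2 with hb
  have hbpos : 0 < b := by
    have : B r₁ ≠ 0 := by
      intro h0; rw [h0] at hV; simp at hV
    positivity
  have hVlin : MonotoneOn (fun s => B s * Q s - k * b * s) (Ici r₁) := by
    refine swz_mono _ _ (fun r => (Q r ^ 2 / (r * (r - 2 * m)) +
      (4 * m ^ 2 / (r * (r - 2 * m)) + (k + 2)) * B r ^ 2) - k * b * 1)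
      (fun r h => ((hVd r (hsub h)).mono hsub).sub
        (((hasDerivAt_id' r).const_mul (k * b)).hasDerivWithinAt)) fun r h => ?_
    have h1 := hp r (hsub h)
    have h2 : b ≤ B r ^ 2 := hSm self_mem_Ici h h
    have h3 : 0 ≤ Q r ^ 2 / (r * (r - 2 * m)) := by positivity
    have h4 : 0 ≤ 4 * m ^ 2 / (r * (r - 2 * m)) * B r ^ 2 := by positivity
    nlinarith
  have hVge : ∀ r ∈ Ici r₁, k * b * (r - r₁) ≤ B r * Q r := fun r h => by
    have : B r₁ * Q r₁ - k * b * r₁ ≤ B r * Q r - k * b * r := hVlin self_mem_Ici h h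
    linarith
  set R := 2 * r₁ + 2 * |m| with hR
  have habs := abs_nonneg m
  have hR1 : r₁ ≤ R := by linarith
  have hsubR : Ici R ⊆ Ici r₁ := Ici_subset_Ici.2 hR1
  have hLog : MonotoneOn (fun s => B s ^ 2 - k * b / 2 * Real.log s) (Ici R) := by
    refine swz_mono _ _ (fun r => 2 * (B r * Q r) / (r * (r - 2 * m)) - k * b / 2 * r⁻¹)
      (fun r h => ((hSd r (hsub (hsubR h))).mono (hsubR.trans hsub)).sub
        (((Real.hasDerivAt_log ?_).const_mul (k * b / 2)).hasDerivWithinAt)) fun r h => ?_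
    · have : R ≤ r := h
      linarith
    · have hRr : R ≤ r := h
      have h0 : 0 < r := by linarith
      have h1 := hp r (hsub (hsubR h))
      have h2 := hVge r (hsubR h)
      have h3 : r * (r - 2 * m) ≤ 2 * r ^ 2 := by
        have := neg_abs_le m
        nlinarith
      have h4 : k * b * (r / 2) ≤ B r * Q r := by
        refine le_trans ?_ h2
        have : 0 < k * b := by positivity
        apply mul_le_mul_of_nonneg_left _ this.le
        linarith
      rw [sub_nonneg, le_div_iff₀ h1]
      calc k * b / 2 * r⁻¹ * (r * (r - 2 * m)) ≤ k * b / 2 * r⁻¹ * (2 * r ^ 2) := by gcongr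
        _ = 2 * (k * b * (r / 2)) := by field_simp
        _ ≤ _ := by linarith
  have hT : Tendsto (fun s => B s ^ 2) atTop atTop := by
    have hlog : Tendsto (fun s => k * b / 2 * Real.log s + (B R ^ 2 - k * b / 2 * Real.log R))
        atTop atTop := by
      apply tendsto_atTop_add_const_right
      exact Real.tendsto_log_atTop.const_mul_atTop (by positivity)
    refine tendsto_atTop_mono' _ ?_ hlog
    filter_upwards [eventually_ge_atTop R] with r hr
    have : B R ^ 2 - k * b / 2 * Real.log R ≤ B r ^ 2 - k * b / 2 * Real.log r :=
      hLog self_mem_Ici hr hr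
    linarith
  exact not_tendsto_nhds_of_tendsto_atTop hT _ (hL.pow 2)

lemma swz_core (m r₀ k : ℝ) (hm : m ≠ 0) (hk : 0 < k) (hr : 0 < r₀) (hr2 : 0 < r₀ - 2 * m)
    (B Q : ℝ → ℝ)
    (hB : ∀ r ∈ Ici r₀, HasDerivWithinAt B (Q r / (r * (r - 2 * m))) (Ici r₀) r)
    (hQ : ∀ r ∈ Ici r₀, HasDerivWithinAt Q
      ((4 * m ^ 2 / (r * (r - 2 * m)) + (k + 2)) * B r) (Ici r₀) r)
    (c : ℝ) (hc : 0 < c) (hB0 : B r₀ = c * swzD m k r₀) (hQ0 : Q r₀ = c * swzN m k r₀)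
    (L : ℝ) (hL : Tendsto B atTop (nhds L)) : False := by
  have hV := swz_V m r₀ k hk hr hr2 B Q hB hQ L hL
  have hp1 : ∀ r ∈ Ici r₀, 0 < r := fun r h => lt_of_lt_of_le hr h
  have hp2 : ∀ r ∈ Ici r₀, 0 < r - 2 * m := fun r h => by
    have : r₀ ≤ r := h
    linarith
  have hp : ∀ r ∈ Ici r₀, 0 < r * (r - 2 * m) := fun r h => mul_pos (hp1 r h) (hp2 r h)
  have hN : ∀ r ∈ Ici r₀, 0 < swzN m k r := fun r h => swzN_pos m k r hm hk (hp1 r h) (hp2 r h)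
  have hmem : r₀ ∈ Ici r₀ := self_mem_Ici
  have hQpos : 0 < Q r₀ := by rw [hQ0]; exact mul_pos hc (hN _ hmem)
  have hBneg0 : B r₀ ≤ 0 := by
    by_contra h
    push Not at h
    have := mul_pos h hQpos
    have := hV r₀ hmem
    linarith
  have hD0 : swzD m k r₀ ≤ 0 := by
    by_contra h
    push Not at h
    have := mul_pos hc h
    linarith
  -- the square is antitone
  have hS : ∀ x ∈ Ici r₀, ∀ y ∈ Ici r₀, x ≤ y → B y ^ 2 ≤ B x ^ 2 := by
    have : MonotoneOn (fun s => -(B s ^ 2)) (Ici r₀) := by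
      refine swz_mono _ _ (fun r => -(2 * (B r * Q r) / (r * (r - 2 * m)))) (fun r h => ?_)
        fun r h => ?_
      · refine ((hB r h).pow 2).neg.congr_deriv ?_
        simp; ring
      · have h1 := hp r h
        have h2 := hV r h
        rw [neg_nonneg]
        apply div_nonpos_of_nonpos_of_nonneg <;> linarith
    intro x hx y hy hxy
    have h := this hx hy hxy
    simp only [neg_le_neg_iff] at h
    exact h
  have hBc : ContinuousOn B (Ici r₀) := fun r h => (hB r h).continuousWithinAt
  have hBnp : ∀ r ∈ Ici r₀, B r ≤ 0 := by
    intro r h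
    by_contra hpos
    push Not at hpos
    obtain ⟨s, hs, hs0⟩ := intermediate_value_Icc (show r₀ ≤ r from h)
      (hBc.mono Icc_subset_Ici_self) (show (0 : ℝ) ∈ Icc (B r₀) (B r) from ⟨hBneg0, hpos.le⟩)
    have := hS s hs.1 r h hs.2
    rw [hs0] at this
    nlinarith
  have hBm : MonotoneOn B (Ici r₀) := by
    intro x hx y hy hxy
    have h1 := hS x hx y hy hxy
    have h2 := hBnp x hx
    have h3 := hBnp y hy
    nlinarith
  have hQnn : ∀ r ∈ Ici r₀, 0 ≤ Q r := by
    intro r h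
    have h1 : 0 ≤ derivWithin B (Ici r₀) r := hBm.derivWithin_nonneg
    rw [(hB r h).derivWithin (uniqueDiffOn_Ici r₀ r h)] at h1
    by_contra hneg
    push Not at hneg
    have := div_neg_of_neg_of_pos hneg (hp r h)
    linarith
  -- the integrating factor
  set g : ℝ → ℝ := fun r => swzD m k r / swzN m k r * (4 * m ^ 2 / (r * (r - 2 * m)) + (k + 2))
    with hg
  have hDc : Continuous (swzD m k) := by unfold swzD; fun_prop
  have hNc : Continuous (swzN m k) := by unfold swzN; fun_prop
  have hgc : ContinuousOn g (Ici r₀) := by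
    apply ContinuousOn.mul
    · exact hDc.continuousOn.div hNc.continuousOn fun r h => (hN r h).ne'
    · apply ContinuousOn.add _ continuousOn_const
      exact continuousOn_const.div (by fun_prop) fun r h => (hp r h).ne'
  have hgc' : Continuous (fun r => g (max r r₀)) :=
    hgc.comp_continuous (by fun_prop) fun r => mem_Ici.2 (le_max_right _ _)
  set Γ : ℝ → ℝ := fun r => ∫ s in r₀..r, g (max s r₀) with hΓ
  have hΓd : ∀ r ∈ Ici r₀, HasDerivWithinAt Γ (g r) (Ici r₀) r := by
    intro r h
    have := (hgc'.integral_hasStrictDerivAt r₀ r).hasDerivAt.hasDerivWithinAt (s := Ici r₀)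
    rwa [max_eq_left (show r₀ ≤ r from h)] at this
  set F : ℝ → ℝ := fun r => (B r - swzD m k r / swzN m k r * Q r) * Real.exp (Γ r) with hF
  set f : ℝ → ℝ := fun r => Real.exp (Γ r) * (Q r / (r * (r - 2 * m)) *
    (k * (k + 2) / 4 * (r * (r - 2 * m) * (k * r + 6 * m)) ^ 2) / swzN m k r ^ 2) with hf
  have hFd : ∀ r ∈ Ici r₀, HasDerivWithinAt F (f r) (Ici r₀) r := by
    intro r h
    have hN0 := (hN r h).ne'
    have hp0 := (hp r h).ne'
    have h1 := ((hB r h).sub ((((swzD_deriv m k r).div (swzN_deriv m k r) hN0).hasDerivWithinAt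
      (s := Ici r₀)).mul (hQ r h))).mul (hΓd r h).exp
    refine h1.congr_deriv ?_
    simp only [hf, hg, ← swz_E, Pi.sub_apply, Pi.mul_apply, Pi.div_apply]
    generalize swzN m k r = n at *
    generalize swzD m k r = d at *
    generalize swzN' m k r = n' at *
    have hr0 := (hp1 r h).ne'
    have hr20 := (hp2 r h).ne'
    field_simp
    ring
  have hfnn : ∀ r ∈ Ici r₀, 0 ≤ f r := by
    intro r h
    have h1 := hp r h
    have h2 := hN r h
    have h3 := hQnn r h
    positivity
  have hFm := swz_mono _ _ _ hFd hfnn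
  have hF0 : F r₀ = 0 := by
    have := (hN r₀ hmem).ne'
    simp only [hF, hB0, hQ0]
    field_simp
    ring
  have hf0 : 0 < f r₀ := by
    have h1 := hp r₀ hmem
    have h2 := hN r₀ hmem
    have h3 : k * r₀ + 6 * m ≠ 0 := by
      intro h
      have hm' : m = -(k * r₀) / 6 := by linarith
      have : swzD m k r₀ = k * r₀ ^ 2 + k ^ 2 * r₀ ^ 2 / 3 := by
        rw [hm']; unfold swzD; ring
      have : 0 < swzD m k r₀ := by rw [this]; positivity
      linarith
    positivity
  obtain ⟨R, hR0, hRD⟩ : ∃ R, r₀ < R ∧ 0 ≤ swzD m k R := by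
    refine ⟨r₀ + 3 * |m| + 6 * m ^ 2 / k + 1 + 6 * m ^ 2, ?_, ?_⟩
    · have := abs_nonneg m
      have : 0 ≤ 6 * m ^ 2 / k := by positivity
      nlinarith [sq_nonneg m]
    · set q := 6 * m ^ 2 / k with hq
      have h6 : 6 * m ^ 2 = q * k := by rw [hq]; field_simp
      have h1 : 0 ≤ q := by positivity
      have h2 := le_abs_self m
      have h3 := abs_nonneg m
      have h4 := sq_nonneg m
      unfold swzD
      have h5 : q ≤ (r₀ + 3 * |m| + q + 1 + 6 * m ^ 2) *
          (r₀ + 3 * |m| + q + 1 + 6 * m ^ 2 - 3 * m) := by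
        have ha : 1 ≤ r₀ + 3 * |m| + q + 1 + 6 * m ^ 2 := by linarith
        have hb : q ≤ r₀ + 3 * |m| + q + 1 + 6 * m ^ 2 - 3 * m := by linarith
        nlinarith
      nlinarith
  have hFR : F R ≤ 0 := by
    have hRm : R ∈ Ici r₀ := hR0.le
    have h1 := hN R hRm
    have h2 := hQnn R hRm
    have h3 := hBnp R hRm
    have h4 : 0 ≤ swzD m k R / swzN m k R * Q R := by positivity
    exact mul_nonpos_of_nonpos_of_nonneg (by linarith) (Real.exp_pos _).le
  have hFz : ∀ r ∈ Icc r₀ R, F r = 0 := by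
    intro r h
    have h1 : F r₀ ≤ F r := hFm hmem h.1 h.1
    have h2 : F r ≤ F R := hFm h.1 (show R ∈ Ici r₀ from hR0.le) h.2
    linarith
  have hd1 : HasDerivWithinAt F (f r₀) (Icc r₀ R) r₀ := (hFd r₀ hmem).mono Icc_subset_Ici_self
  have hd2 : HasDerivWithinAt F 0 (Icc r₀ R) r₀ :=
    (hasDerivWithinAt_const r₀ (Icc r₀ R) (0 : ℝ)).congr hFz hF0
  have := (uniqueDiffOn_Icc hR0 r₀ ⟨le_rfl, hR0.le⟩).eq_deriv _ hd1 hd2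
  linarith

/-- For `m ≠ 0` and `ℓ ≥ 2`, with `α₀`, `β₀`, `B` as in the paper, either
`B → +∞`, or `B → −∞`, or (if `a' → 0`) `a` has no finite limit at infinity. -/
theorem schwarzschild_radial_ode_ell_ge_two_trichotomy
    (m r₀ : ℝ) (hm : m ≠ 0) (hr₀ : 2 * max 0 m < r₀)
    (ℓ : ℕ) (hℓ : 2 ≤ ℓ)
    (a : ℝ → ℝ) (ha : ContDiffOn ℝ 2 a (Ici r₀))
    (hode : ∀ r ∈ Ici r₀,
      derivWithin (fun s => s * (s - 2 * m) * derivWithin a (Ici r₀) s) (Ici r₀) r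
        = (4 * m ^ 2 / (r * (r - 2 * m)) + (ℓ : ℝ) * ((ℓ : ℝ) + 1)) * a r
          - (2 * m / (r * (r - 2 * m))) *
            ((4 * m - r₀) * a r₀ + r₀ * (r₀ - 2 * m) * derivWithin a (Ici r₀) r₀))
    (hinit : derivWithin a (Ici r₀) r₀
        = (1 / (2 * (r₀ - 2 * m))) * ((ℓ : ℝ) * ((ℓ : ℝ) + 1) - 2 * m / r₀) * a r₀)
    (ha0 : a r₀ ≠ 0)
    (α₀ β₀ : ℝ) (B : ℝ → ℝ)
    (hα₀ : α₀ = (3 / 2 + (r₀ / (4 * m)) * ((ℓ : ℝ) * ((ℓ : ℝ) + 1) - 2)) * a r₀)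
    (hβ₀ : β₀ = 4 * m ^ 2 * α₀ / ((ℓ : ℝ) * ((ℓ : ℝ) + 1) - 2))
    (hBdef : ∀ r, B r = a r - β₀ / (r * (r - 2 * m))) :
    Tendsto B atTop atTop ∨ Tendsto B atTop atBot ∨
      (Tendsto (derivWithin a (Ici r₀)) atTop (nhds 0) →
        ¬ ∃ L : ℝ, Tendsto a atTop (nhds L)) := by
  have hr₀0 : 0 < r₀ := by have := le_max_left 0 m; linarith
  have hr₀2 : 0 < r₀ - 2 * m := by have := le_max_right 0 m; linarith
  have hne2 : r₀ - 2 * m ≠ 0 := hr₀2.ne'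
  obtain ⟨k, hk⟩ : ∃ k : ℝ, k = (ℓ : ℝ) * ((ℓ : ℝ) + 1) - 2 := ⟨_, rfl⟩
  have hl : (ℓ : ℝ) * ((ℓ : ℝ) + 1) = k + 2 := by linarith
  have hkpos : 0 < k := by
    have : (2 : ℝ) ≤ ℓ := by exact_mod_cast hℓ
    nlinarith
  rw [hl] at hα₀ hβ₀ hinit
  simp only [hl] at hode
  rw [show k + 2 - 2 = k by ring] at hα₀ hβ₀
  right; right
  rintro - ⟨L, hL⟩
  have hp1 : ∀ r ∈ Ici r₀, 0 < r := fun r h => lt_of_lt_of_le hr₀0 h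
  have hp2 : ∀ r ∈ Ici r₀, 0 < r - 2 * m := fun r h => by
    have : r₀ ≤ r := h
    linarith
  have hmem : r₀ ∈ Ici r₀ := self_mem_Ici
  have hud := uniqueDiffOn_Ici r₀
  have hpd : ∀ r : ℝ, HasDerivAt (fun s : ℝ => s * (s - 2 * m)) (2 * r - 2 * m) r := fun r => by
    refine ((hasDerivAt_id' r).mul ((hasDerivAt_id' r).sub_const (2 * m))).congr_deriv ?_
    ring
  set A := derivWithin a (Ici r₀) with hA
  have had : ∀ r ∈ Ici r₀, HasDerivWithinAt a (A r) (Ici r₀) r := fun r h =>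
    ((ha.differentiableOn (by norm_num)) r h).hasDerivWithinAt
  have hAd : DifferentiableOn ℝ A (Ici r₀) :=
    (ha.derivWithin hud (m := 1) (by norm_num)).differentiableOn (by norm_num)
  -- the inhomogeneity
  have hC : (4 * m - r₀) * a r₀ + r₀ * (r₀ - 2 * m) * A r₀ = 2 * m * α₀ := by
    rw [hinit, hα₀]
    clear_value A
    clear hA had hAd hinit hode
    generalize hu : r₀ - 2 * m = u at hne2 ⊢
    field_simp
    subst hu
    ring
  have hβk : 4 * m ^ 2 * α₀ = k * β₀ := by rw [hβ₀]; field_simp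
  set Q : ℝ → ℝ := fun r => r * (r - 2 * m) * A r + β₀ * ((2 * r - 2 * m) / (r * (r - 2 * m)))
    with hQdef
  have hBfun : B = fun r => a r - β₀ / (r * (r - 2 * m)) := funext hBdef
  have hBd : ∀ r ∈ Ici r₀, HasDerivWithinAt B (Q r / (r * (r - 2 * m))) (Ici r₀) r := by
    intro r h
    have h1 := (hp1 r h).ne'
    have h2 := (hp2 r h).ne'
    rw [hBfun]
    refine ((had r h).sub (((hasDerivAt_const r β₀).div (hpd r)
      (mul_ne_zero h1 h2)).hasDerivWithinAt)).congr_deriv ?_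
    simp only [hQdef]
    field_simp
    ring
  have hQd : ∀ r ∈ Ici r₀, HasDerivWithinAt Q
      ((4 * m ^ 2 / (r * (r - 2 * m)) + (k + 2)) * B r) (Ici r₀) r := by
    intro r h
    have h1 := (hp1 r h).ne'
    have h2 := (hp2 r h).ne'
    have hd1 : HasDerivWithinAt (fun s => s * (s - 2 * m) * A s) 
        (derivWithin (fun s => s * (s - 2 * m) * A s) (Ici r₀) r) (Ici r₀) r :=
      (((hpd r).differentiableAt.differentiableWithinAt).mul (hAd r h)).hasDerivWithinAt
    rw [hode r h, hC] at hd1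
    have hd2 := ((((hasDerivAt_id' r).const_mul 2).sub_const (2 * m)).div (hpd r)
      (mul_ne_zero h1 h2)).const_mul β₀
    refine (hd1.add hd2.hasDerivWithinAt).congr_deriv ?_
    rw [hBdef]
    have e : 2 * m / (r * (r - 2 * m)) * (2 * m * α₀) = k * β₀ / (r * (r - 2 * m)) := by
      rw [← hβk]; ring
    rw [e]
    clear hd1 hd2 e
    generalize hu : r - 2 * m = u at h2 ⊢
    field_simp
    subst hu
    ring
  set c := a r₀ / (k * (r₀ * (r₀ - 2 * m))) with hc
  have hβ' : β₀ = (6 * m ^ 2 / k + m * r₀) * a r₀ := by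
    rw [hβ₀, hα₀]; field_simp; ring
  have hB0 : B r₀ = c * swzD m k r₀ := by
    rw [hBdef, hβ', hc]
    unfold swzD
    generalize hu : r₀ - 2 * m = u at hne2 ⊢
    field_simp
    subst hu
    ring
  have hQ0 : Q r₀ = c * swzN m k r₀ := by
    simp only [hQdef]
    rw [hinit, hβ', hc]
    unfold swzN
    generalize hu : r₀ - 2 * m = u at hne2 ⊢
    field_simp
  have hcne : c ≠ 0 := div_ne_zero ha0 (by positivity)
  obtain ⟨M, hM⟩ : ∃ M, Tendsto B atTop (nhds M) := by
    have hpT : Tendsto (fun r : ℝ => r * (r - 2 * m)) atTop atTop :=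
      tendsto_id.atTop_mul_atTop₀ (tendsto_atTop_add_const_right _ (-(2 * m)) tendsto_id)
    exact ⟨L - 0, by rw [hBfun]; exact hL.sub (hpT.const_div_atTop β₀)⟩
  rcases lt_or_gt_of_ne hcne with h | h
  · refine swz_core m r₀ k hm hkpos hr₀0 hr₀2 (fun r => - B r) (fun r => - Q r)
      (fun r hr => (hBd r hr).neg.congr_deriv (by ring))
      (fun r hr => (hQd r hr).neg.congr_deriv (by ring)) (-c) (by linarith)
      (by simp [hB0]) (by simp [hQ0]) (-M) hM.neg
  · exact swz_core m r₀ k hm hkpos hr₀0 hr₀2 B Q hBd hQd c h hB0 hQ0 M hM
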